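/- Let F₂ be the free group on two generators and p ≥ 1. Then the equivariant L^p-compression of F₂ equals max(1/2, 1/p). -/

import Mathlib

open MeasureTheory

/-- Word length of a group element with respect to a set `S` (letters from `S ∪ S⁻¹`). -/
noncomputable def wordLength {G : Type*} [Group G] (S : Set G) (g : G) : ℕ :=
  sInf {n | ∃ w : List G, w.length = n ∧ (∀ x ∈ w, x ∈ S ∨ x⁻¹ ∈ S) ∧ w.prod = g}

/-- The word metric on a group with respect to a generating set `S`. -/
noncomputable def wordDist {G : Type*} [Group G] (S : Set G) (g h : G) : ℝ :=
  wordLength S (g⁻¹ * h)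

/-- The set of compression exponents `r ∈ [0,1]` realized by 1-cocycles of affine
isometric actions of `G` on `L^p`-spaces: there is a measure space `(Ω, μ)`, a linear
isometric representation `π` of `G` on `L^p(Ω, μ)` and a Lipschitz 1-cocycle `b` for
`π` with `(1/C)·dist(g,h)^r − D ≤ ‖b g − b h‖` for some constants `C, D > 0`. -/
def equivCompressionSet (G : Type*) [Group G] (dist : G → G → ℝ) (p : ℝ)
    [Fact (1 ≤ ENNReal.ofReal p)] : Set ℝ :=
  {r | 0 ≤ r ∧ r ≤ 1 ∧ ∃ (Ω : Type) (_ : MeasurableSpace Ω) (μ : Measure Ω)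
    (π : G →* (Lp ℝ (ENNReal.ofReal p) μ ≃ₗᵢ[ℝ] Lp ℝ (ENNReal.ofReal p) μ))
    (b : G → Lp ℝ (ENNReal.ofReal p) μ),
    (∀ g h : G, b (g * h) = π g (b h) + b g) ∧
    (∃ L : ℝ, 0 < L ∧ ∀ g h : G, ‖b g - b h‖ ≤ L * dist g h) ∧
    (∃ C : ℝ, 0 < C ∧ ∃ D : ℝ, 0 < D ∧
      ∀ g h : G, (1 / C) * dist g h ^ r - D ≤ ‖b g - b h‖)}

/-- The equivariant `L^p`-compression of `G` (with respect to the metric `dist`). -/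
noncomputable def equivCompression (G : Type*) [Group G] (dist : G → G → ℝ)
    (p : ℝ) [Fact (1 ≤ ENNReal.ofReal p)] : ℝ :=
  sSup (equivCompressionSet G dist p)

/-- Pointwise smoothness at `1` of `x ↦ |x| ^ p`. -/
lemma abs_one_add_rpow_le {p : ℝ} (hp : 1 ≤ p) (b : ℝ) :
    (p * |b| ≤ 1 ∧ |1 + b| ^ p ≤ 1 + p * b + p ^ 2 * b ^ 2) ∨
      (1 ≤ p * |b| ∧ |1 + b| ^ p ≤ 1 + p * b + ((p + 1) ^ p + p ^ p) * |b| ^ p) := by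
  have hp0 : 0 < p := by linarith
  rcases le_total (p * |b|) 1 with h | h
  · left
    refine ⟨h, ?_⟩
    have hb : |p * b| ≤ 1 := by rwa [abs_mul, abs_of_pos hp0]
    have hb1 : |b| ≤ 1 := by nlinarith [abs_nonneg b]
    have h1 : 0 ≤ 1 + b := by linarith [(abs_le.1 hb1).1]
    have h2 := (abs_le.1 (Real.abs_exp_sub_one_sub_id_le hb)).2
    calc |1 + b| ^ p = (1 + b) ^ p := by rw [abs_of_nonneg h1]
      _ ≤ (Real.exp b) ^ p := by gcongr; linarith [Real.add_one_le_exp b]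
      _ = Real.exp (p * b) := by rw [← Real.exp_mul, mul_comm]
      _ ≤ _ := by nlinarith
  · right
    refine ⟨h, ?_⟩
    have h1 : |1 + b| ≤ (p + 1) * |b| := by
      have := abs_add_le 1 b
      rw [abs_one] at this
      linarith
    have h2 : |1 + b| ^ p ≤ (p + 1) ^ p * |b| ^ p := by
      rw [← Real.mul_rpow (by linarith) (abs_nonneg b)]
      gcongr
    have h3 : p * |b| ≤ p ^ p * |b| ^ p := by
      rw [← Real.mul_rpow hp0.le (abs_nonneg b)]
      exact Real.self_le_rpow_of_one_le h hp
    nlinarith [neg_abs_le b]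

/-- Uniform smoothness of `x ↦ |x| ^ p` at `1` with a small multiplicative error `ε`. -/
lemma exists_abs_one_add_rpow_le {p : ℝ} (hp : 1 ≤ p) :
    ∃ C : ℝ, 0 < C ∧ ∀ ε : ℝ, 0 < ε → ε ≤ 1 → ∀ b : ℝ,
      |1 + b| ^ p ≤ 1 + ε + p * b + C * ε ^ (-(max (p / 2 - 1) 0)) * |b| ^ p := by
  have hp0 : 0 < p := by linarith
  set θ : ℝ := max (p / 2 - 1) 0 with hθ
  have hθ0 : 0 ≤ θ := le_max_right _ _
  refine ⟨p ^ 2 * (p ^ 2) ^ θ + ((p + 1) ^ p + p ^ p), by positivity, fun ε hε hε1 b => ?_⟩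
  have he : 1 ≤ ε ^ (-θ) := Real.one_le_rpow_of_pos_of_le_one_of_nonpos hε hε1 (by linarith)
  have hA : 0 ≤ (p + 1) ^ p + p ^ p := by positivity
  have hB : 0 ≤ p ^ 2 * (p ^ 2) ^ θ := by positivity
  have hbp : 0 ≤ |b| ^ p := by positivity
  rcases abs_one_add_rpow_le hp b with ⟨hb, h⟩ | ⟨-, h⟩
  · rcases le_total (p ^ 2 * b ^ 2) ε with h' | h'
    · have : 0 ≤ (p ^ 2 * (p ^ 2) ^ θ + ((p + 1) ^ p + p ^ p)) * ε ^ (-θ) * |b| ^ p := by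
        positivity
      linarith
    · have hb1 : |b| ≤ 1 := by nlinarith [abs_nonneg b]
      have hb0 : 0 < |b| := by
        rw [abs_pos]
        rintro rfl
        norm_num at h'
        linarith
      have h1 : |b| ^ (-(2 * θ)) ≤ (p ^ 2) ^ θ * ε ^ (-θ) := by
        rw [Real.rpow_neg hε.le, ← div_eq_mul_inv, ← Real.div_rpow (by positivity) hε.le,
          ← mul_neg, Real.rpow_mul hb0.le, Real.rpow_neg (by positivity),
          ← Real.inv_rpow (by positivity)]
        refine Real.rpow_le_rpow (by positivity) ?_ hθ0
        rw [Real.rpow_two, sq_abs, inv_eq_one_div, div_le_div_iff₀ (by rw [← sq_abs]; positivity) hε]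
        linarith
      have h2 : b ^ 2 ≤ (p ^ 2) ^ θ * ε ^ (-θ) * |b| ^ p := by
        calc b ^ 2 = |b| ^ (2 : ℝ) := by rw [Real.rpow_two, sq_abs]
          _ ≤ |b| ^ (-(2 * θ) + p) := by
            refine Real.rpow_le_rpow_of_exponent_ge hb0 hb1 ?_
            linarith [le_max_left (p / 2 - 1) 0]
          _ = |b| ^ (-(2 * θ)) * |b| ^ p := Real.rpow_add hb0 _ _
          _ ≤ _ := by gcongr
      have h3 : 0 ≤ ((p + 1) ^ p + p ^ p) * ε ^ (-θ) * |b| ^ p := by positivity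
      have h4 := mul_le_mul_of_nonneg_left h2 (sq_nonneg p)
      nlinarith
  · have : ((p + 1) ^ p + p ^ p) * |b| ^ p ≤
        (p ^ 2 * (p ^ 2) ^ θ + ((p + 1) ^ p + p ^ p)) * ε ^ (-θ) * |b| ^ p := by
      gcongr
      nlinarith
    linarith

/-- Averaged smoothness of `x ↦ |x| ^ p` over centred increments. -/
lemma exists_sum_abs_add_rpow_le {p : ℝ} (hp : 1 ≤ p) :
    ∃ C : ℝ, 0 < C ∧ ∀ ε : ℝ, 0 < ε → ε ≤ 1 → ∀ {ι : Type} [Fintype ι] (a : ℝ) (y : ι → ℝ),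
      ∑ i, y i = 0 → ∑ i, |a + y i| ^ p ≤
        ∑ i, ((1 + ε) * |a| ^ p + C * ε ^ (-(max (p / 2 - 1) 0)) * |y i| ^ p) := by
  obtain ⟨C, hC, H⟩ := exists_abs_one_add_rpow_le hp
  refine ⟨C + 1, by linarith, fun ε hε hε1 ι _ a y hy => ?_⟩
  have hp0 : 0 < p := by linarith
  have he : 1 ≤ ε ^ (-(max (p / 2 - 1) 0)) :=
    Real.one_le_rpow_of_pos_of_le_one_of_nonpos hε hε1 (by linarith [le_max_right (p / 2 - 1) 0])
  rcases eq_or_ne a 0 with rfl | ha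
  · refine Finset.sum_le_sum fun i _ => ?_
    have h0 : 0 ≤ |y i| ^ p := by positivity
    have h1 : 1 ≤ (C + 1) * ε ^ (-(max (p / 2 - 1) 0)) := by nlinarith
    simp only [zero_add, abs_zero, Real.zero_rpow hp0.ne', mul_zero]
    nlinarith
  · have key : ∀ i, |a + y i| ^ p ≤ (1 + ε) * |a| ^ p + p * |a| ^ p / a * y i +
        C * ε ^ (-(max (p / 2 - 1) 0)) * |y i| ^ p := by
      intro i
      have h1 := mul_le_mul_of_nonneg_left (H ε hε hε1 (y i / a))
        (by positivity : 0 ≤ |a| ^ p)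
      rw [← Real.mul_rpow (abs_nonneg _) (abs_nonneg _), ← abs_mul, mul_add, mul_one,
        mul_div_cancel₀ _ ha] at h1
      have h2 : |y i| ^ p = |a| ^ p * |y i / a| ^ p := by
        rw [← Real.mul_rpow (abs_nonneg _) (abs_nonneg _), ← abs_mul, mul_div_cancel₀ _ ha]
      rw [h2]
      refine h1.trans (le_of_eq ?_)
      field_simp
    calc ∑ i, |a + y i| ^ p ≤ _ := Finset.sum_le_sum fun i _ => key i
      _ = ∑ i, ((1 + ε) * |a| ^ p + C * ε ^ (-(max (p / 2 - 1) 0)) * |y i| ^ p) := by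
        simp only [Finset.sum_add_distrib, ← Finset.mul_sum, hy, mul_zero, add_zero]
      _ ≤ _ := by
        gcongr
        linarith

lemma norm_Lp_rpow {Ω : Type*} [MeasurableSpace Ω] {μ : Measure Ω} {p : ℝ} (hp : 1 ≤ p)
    (f : Lp ℝ (ENNReal.ofReal p) μ) :
    Integrable (fun x => |f x| ^ p) μ ∧ ‖f‖ ^ p = ∫ x, |f x| ^ p ∂μ := by
  have hp0 : 0 < p := by linarith
  have h0 : ENNReal.ofReal p ≠ 0 := by simpa using hp0
  have hm := Lp.memLp f
  constructor
  · simpa [ENNReal.toReal_ofReal hp0.le] using hm.integrable_norm_rpow h0 ENNReal.ofReal_ne_top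
  · rw [Lp.norm_def, hm.eLpNorm_eq_integral_rpow_norm h0 ENNReal.ofReal_ne_top,
      ENNReal.toReal_ofReal (by positivity), ENNReal.toReal_ofReal hp0.le, ← Real.rpow_mul
      (by positivity), inv_mul_cancel₀ hp0.ne', Real.rpow_one]
    rfl

/-- Averaged smoothness of the `p`-th power of the `L^p` norm over centred increments. -/
lemma exists_sum_norm_add_rpow_le {p : ℝ} (hp : 1 ≤ p) :
    ∃ C : ℝ, 0 < C ∧ ∀ ε : ℝ, 0 < ε → ε ≤ 1 → ∀ {Ω : Type} [MeasurableSpace Ω] {μ : Measure Ω}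
      {ι : Type} [Fintype ι] (a : Lp ℝ (ENNReal.ofReal p) μ) (y : ι → Lp ℝ (ENNReal.ofReal p) μ),
      ∑ i, y i = 0 → ∑ i, ‖a + y i‖ ^ p ≤
        ∑ i, ((1 + ε) * ‖a‖ ^ p + C * ε ^ (-(max (p / 2 - 1) 0)) * ‖y i‖ ^ p) := by
  obtain ⟨C, hC, H⟩ := exists_sum_abs_add_rpow_le hp
  refine ⟨C, hC, fun ε hε hε1 Ω _ μ ι _ a y hy => ?_⟩
  have hi := fun f : Lp ℝ (ENNReal.ofReal p) μ => (norm_Lp_rpow hp f).1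
  simp only [(norm_Lp_rpow hp _).2, ← integral_const_mul]
  have hi2 : ∀ i, Integrable (fun x => (1 + ε) * |a x| ^ p +
      C * ε ^ (-(max (p / 2 - 1) 0)) * |y i x| ^ p) μ := fun i =>
    ((hi a).const_mul _).add ((hi (y i)).const_mul _)
  simp_rw [← integral_add ((hi a).const_mul _) ((hi (y _)).const_mul _)]
  rw [← integral_finsetSum _ fun i _ => hi _, ← integral_finsetSum _ fun i _ => hi2 i]
  refine integral_mono_ae (integrable_finsetSum _ fun i _ => hi _)
    (integrable_finsetSum _ fun i _ => hi2 i) ?_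
  have h1 : ∀ᵐ x ∂μ, ∀ i, (a + y i : Lp ℝ (ENNReal.ofReal p) μ) x = a x + y i x :=
    ae_all_iff.2 fun i => Lp.coeFn_add _ _
  have h2 : ∀ᵐ x ∂μ, ∑ i, y i x = 0 := by
    have h3 := Lp.coeFn_finsetSum Finset.univ y
    have h4 := Lp.coeFn_zero ℝ (ENNReal.ofReal p) μ
    rw [hy] at h3
    filter_upwards [h3, h4] with x h3 h4
    rw [h4] at h3
    simpa using h3.symm
  filter_upwards [h1, h2] with x h1 h2
  simp only [h1]
  exact H ε hε hε1 _ _ h2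

/-- The average of `f` over the words of length `n` in the alphabet `κ`. -/
noncomputable def wordAvg {κ : Type} [Fintype κ] : ℕ → (List κ → ℝ) → ℝ
  | 0, f => f []
  | n + 1, f => wordAvg n fun l => (∑ i, f (i :: l)) / Fintype.card κ

section WordAvg

variable {κ : Type} [Fintype κ]

lemma wordAvg_mono (n : ℕ) {f g : List κ → ℝ} (h : ∀ l, f l ≤ g l) :
    wordAvg n f ≤ wordAvg n g := by
  induction n generalizing f g with
  | zero => exact h []
  | succ n ih =>
    refine ih fun l => ?_
    gcongr with i
    exact h _

lemma wordAvg_add (n : ℕ) (f g : List κ → ℝ) :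
    wordAvg n (fun l => f l + g l) = wordAvg n f + wordAvg n g := by
  induction n generalizing f g with
  | zero => rfl
  | succ n ih => simp only [wordAvg, Finset.sum_add_distrib, add_div, ih]

lemma wordAvg_const_mul (n : ℕ) (c : ℝ) (f : List κ → ℝ) :
    wordAvg n (fun l => c * f l) = c * wordAvg n f := by
  induction n generalizing f with
  | zero => rfl
  | succ n ih => simp only [wordAvg, ← Finset.mul_sum, mul_div_assoc, ih]

lemma wordAvg_const [Nonempty κ] (n : ℕ) (c : ℝ) : wordAvg (κ := κ) n (fun _ => c) = c := by
  induction n with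
  | zero => rfl
  | succ n ih => simpa [wordAvg] using ih

lemma wordAvg_avg {ι : Type} [Fintype ι] (n : ℕ) (c : ℝ) (f : ι → List κ → ℝ) :
    wordAvg n (fun l => (∑ i, f i l) / c) = (∑ i, wordAvg n (f i)) / c := by
  induction n generalizing f with
  | zero => rfl
  | succ n ih =>
    simp only [wordAvg, ← ih]
    congr 1
    ext l
    rw [← Finset.sum_div, ← Finset.sum_div, Finset.sum_comm, div_right_comm]

lemma wordAvg_succ_append (n : ℕ) (f : List κ → ℝ) :
    wordAvg (n + 1) f = (∑ i, wordAvg n fun l => f (l ++ [i])) / Fintype.card κ := by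
  induction n generalizing f with
  | zero => simp [wordAvg]
  | succ n ih => rw [wordAvg, ih]; rfl

lemma wordAvg_reverse (n : ℕ) (f : List κ → ℝ) :
    wordAvg n (fun l => f l.reverse) = wordAvg n f := by
  induction n generalizing f with
  | zero => rfl
  | succ n ih =>
    rw [wordAvg_succ_append n f, wordAvg, ← wordAvg_avg]
    simp only [List.reverse_cons]
    exact ih fun l => (∑ i, f (l ++ [i])) / Fintype.card κ

lemma wordAvg_map (e : κ ≃ κ) (n : ℕ) (f : List κ → ℝ) :
    wordAvg n (fun l => f (l.map e)) = wordAvg n f := by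
  induction n generalizing f with
  | zero => rfl
  | succ n ih =>
    simp only [wordAvg, List.map_cons]
    rw [← ih fun l => (∑ i, f (i :: l)) / Fintype.card κ]
    congr 1
    ext l
    rw [e.sum_comp fun i => f (i :: l.map e)]

lemma avg_rpow_le [Nonempty κ] {p : ℝ} (hp : 1 ≤ p) (z : κ → ℝ) (hz : ∀ i, 0 ≤ z i) :
    ((∑ i, z i) / Fintype.card κ) ^ p ≤ (∑ i, z i ^ p) / Fintype.card κ := by
  have := Real.rpow_arith_mean_le_arith_mean_rpow Finset.univ
    (fun _ : κ => (1 : ℝ) / Fintype.card κ) z (fun _ _ => by positivity) (by simp)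
    (fun i _ => hz i) hp
  simpa only [one_div_mul_eq_div, ← Finset.sum_div] using this

lemma wordAvg_rpow_le [Nonempty κ] {p : ℝ} (hp : 1 ≤ p) (n : ℕ) {f : List κ → ℝ}
    (hf : ∀ l, 0 ≤ f l) : wordAvg n f ^ p ≤ wordAvg n fun l => f l ^ p := by
  induction n generalizing f with
  | zero => exact le_rfl
  | succ n ih =>
    refine (ih fun l => ?_).trans (wordAvg_mono n fun l => avg_rpow_le hp _ fun i => hf _)
    exact div_nonneg (Finset.sum_nonneg fun i _ => hf _) (by positivity)

lemma le_wordAvg_of_drift [Nonempty κ] {f : List κ → ℝ} (h0 : 0 ≤ f [])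
    (hf : ∀ l, Fintype.card κ * (f l + 1) ≤ ∑ i, f (i :: l)) (n : ℕ) : n ≤ wordAvg n f := by
  have key : ∀ l, f l + 1 ≤ (∑ i, f (i :: l)) / Fintype.card κ := fun l => by
    rw [le_div_iff₀' (by positivity)]
    exact hf l
  induction n with
  | zero => simpa [wordAvg] using h0
  | succ n ih =>
    have := wordAvg_mono n key
    rw [wordAvg_add, wordAvg_const] at this
    push_cast
    exact (by linarith : (n : ℝ) + 1 ≤ wordAvg n f + 1).trans this

/-- Moment bound for an `L^p`-valued martingale with bounded increments indexed by a tree. -/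
lemma wordAvg_martingale_le [Nonempty κ] {p : ℝ} (hp : 1 ≤ p)
    [Fact (1 ≤ ENNReal.ofReal p)] {Ω : Type} [MeasurableSpace Ω] {μ : Measure Ω}
    {M : List κ → Lp ℝ (ENNReal.ofReal p) μ} {L : ℝ}
    (h0 : M [] = 0) (hM : ∀ l, ∑ i, (M (i :: l) - M l) = 0)
    (hL : ∀ l i, ‖M (i :: l) - M l‖ ≤ L) :
    ∃ C : ℝ, 0 < C ∧ ∀ n : ℕ, 0 < n →
      wordAvg n (fun l => ‖M l‖ ^ p) ≤ C * (n : ℝ) ^ (1 + max (p / 2 - 1) 0) := by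
  obtain ⟨C, hC, H⟩ := exists_sum_norm_add_rpow_le hp
  have hp0 : 0 < p := by linarith
  have hL0 : 0 ≤ L := (norm_nonneg _).trans (hL [] (Classical.arbitrary κ))
  refine ⟨Real.exp 1 * (C * L ^ p) + 1, by positivity, fun n hn => ?_⟩
  set θ := max (p / 2 - 1) 0
  have hn0 : (0 : ℝ) < n := by exact_mod_cast hn
  have hn1 : (1 : ℝ) ≤ n := by exact_mod_cast hn
  set B := C * (n : ℝ) ^ θ * L ^ p with hB
  have hB0 : 0 ≤ B := by positivity
  have hstep : ∀ l, (∑ i, ‖M (i :: l)‖ ^ p) / Fintype.card κ ≤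
      (1 + 1 / (n : ℝ)) * ‖M l‖ ^ p + B := by
    intro l
    rw [div_le_iff₀ (by positivity)]
    have h1 := H (1 / n) (by positivity) (by rw [div_le_one hn0]; exact hn1) (M l)
      (fun i => M (i :: l) - M l) (hM l)
    simp only [add_sub_cancel] at h1
    have h2 : ((1 : ℝ) / n) ^ (-θ) = (n : ℝ) ^ θ := by
      rw [one_div, Real.inv_rpow hn0.le, Real.rpow_neg hn0.le, inv_inv]
    rw [h2] at h1
    calc _ ≤ _ := h1
      _ ≤ ∑ i : κ, ((1 + 1 / (n : ℝ)) * ‖M l‖ ^ p + B) := by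
        rw [hB]
        gcongr with i
        exact hL l i
      _ = _ := by rw [Finset.sum_const, Finset.card_univ, nsmul_eq_mul, mul_comm]
  have hk : ∀ k : ℕ, wordAvg k (fun l => ‖M l‖ ^ p) ≤ (1 + 1 / (n : ℝ)) ^ k * (k * B) := by
    intro k
    induction k with
    | zero => simp [wordAvg, h0, Real.zero_rpow hp0.ne']
    | succ k ih =>
      have h1 := wordAvg_mono k hstep
      rw [wordAvg_add, wordAvg_const, wordAvg_const_mul] at h1
      refine h1.trans ?_
      have h2 : 1 ≤ (1 + 1 / (n : ℝ)) ^ (k + 1) := one_le_pow₀ (by simp)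
      have h3 := mul_le_mul_of_nonneg_left ih (by positivity : 0 ≤ 1 + 1 / (n : ℝ))
      calc _ ≤ (1 + 1 / (n : ℝ)) ^ (k + 1) * (k * B) + 1 * B := by
            rw [pow_succ']; linarith
        _ ≤ (1 + 1 / (n : ℝ)) ^ (k + 1) * (k * B) + (1 + 1 / (n : ℝ)) ^ (k + 1) * B := by
            gcongr
        _ = _ := by push_cast; ring
  have he : (1 + 1 / (n : ℝ)) ^ n ≤ Real.exp 1 := by
    calc (1 + 1 / (n : ℝ)) ^ n ≤ Real.exp (1 / n) ^ n := by
          gcongr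
          linarith [Real.add_one_le_exp (1 / (n : ℝ))]
      _ = Real.exp 1 := by rw [← Real.exp_nat_mul, mul_one_div_cancel hn0.ne']
  calc _ ≤ _ := hk n
    _ ≤ Real.exp 1 * (n * B) := by gcongr
    _ = Real.exp 1 * (C * L ^ p) * (n : ℝ) ^ (1 + θ) := by
      rw [hB, Real.rpow_add hn0, Real.rpow_one]; ring
    _ ≤ _ := by
      gcongr
      linarith

end WordAvg

lemma add_rpow_le_two_rpow_mul {p x y : ℝ} (hp : 0 ≤ p) (hx : 0 ≤ x) (hy : 0 ≤ y) :
    (x + y) ^ p ≤ 2 ^ p * (x ^ p + y ^ p) := by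
  have hxp : 0 ≤ x ^ p := by positivity
  have hyp : 0 ≤ y ^ p := by positivity
  have h2 : (0 : ℝ) ≤ 2 ^ p := by positivity
  rcases le_total x y with h | h
  · calc (x + y) ^ p ≤ (2 * y) ^ p := by gcongr; linarith
      _ = 2 ^ p * y ^ p := Real.mul_rpow (by norm_num) hy
      _ ≤ _ := by gcongr; linarith
  · calc (x + y) ^ p ≤ (2 * x) ^ p := by gcongr; linarith
      _ = 2 ^ p * x ^ p := Real.mul_rpow (by norm_num) hx
      _ ≤ _ := by gcongr; linarith

section Cocycle

variable {G ι : Type} [Group G] {V : Type*} [NormedAddCommGroup V] [NormedSpace ℝ V]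

/-- The position after the two-letter steps of `l`, the head of `l` being the latest step. -/
def walk (σ : ι → G) : List (ι × ι) → G
  | [] => 1
  | (s, t) :: l => walk σ l * σ s * σ t

/-- The martingale part, with drift `v`, of a cocycle `b` along `walk σ`. -/
def walkMartingale (σ : ι → G) (π : G →* (V ≃ₗᵢ[ℝ] V)) (b : G → V) (v : V) : List (ι × ι) → V
  | [] => 0
  | (s, t) :: l => walkMartingale σ π b v l + π (walk σ l * σ s) (b (σ t) - v)

variable (σ : ι → G) (π : G →* (V ≃ₗᵢ[ℝ] V)) (b : G → V) (v : V)

lemma walk_append (l : List (ι × ι)) (s t : ι) :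
    walk σ (l ++ [(s, t)]) = σ s * σ t * walk σ l := by
  induction l with
  | nil => simp [walk]
  | cons x l ih => simp [walk, ih, mul_assoc]

lemma walkMartingale_append (l : List (ι × ι)) (s t : ι) :
    walkMartingale σ π b v (l ++ [(s, t)]) =
      π (σ s) (b (σ t) - v) + π (σ s * σ t) (walkMartingale σ π b v l) := by
  induction l with
  | nil => simp [walk, walkMartingale]
  | cons x l ih => simp [walkMartingale, ih, walk_append, mul_assoc, add_assoc]

variable {b}

lemma cocycle_one (hb : ∀ g h : G, b (g * h) = π g (b h) + b g) : b 1 = 0 := by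
  simpa using hb 1 1

/-- A cocycle along the walk is the difference of a forward and a backward martingale. -/
lemma cocycle_walk (hb : ∀ g h : G, b (g * h) = π g (b h) + b g) (τ : ι → ι)
    (hτ : ∀ i, σ (τ i) = (σ i)⁻¹) (l : List (ι × ι)) :
    b (walk σ l) = walkMartingale σ π b v l - π (walk σ l)
      (walkMartingale σ π b v (l.map fun x => (τ x.2, τ x.1)).reverse) := by
  induction l with
  | nil => simp [walk, walkMartingale, cocycle_one π hb]
  | cons x l ih =>
    obtain ⟨s, t⟩ := x
    have hinv : π (σ s) (b (σ s)⁻¹) = - b (σ s) := by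
      have := hb (σ s) (σ s)⁻¹
      rw [mul_inv_cancel, cocycle_one π hb] at this
      exact eq_neg_of_add_eq_zero_left this.symm
    simp only [List.map_cons, List.reverse_cons, walkMartingale_append, hτ, walk]
    rw [hb, hb, ih]
    simp only [walkMartingale, map_add, map_sub, map_mul, LinearIsometryEquiv.coe_mul,
      Function.comp_apply, map_inv, LinearIsometryEquiv.inv_def, hinv, map_neg,
      LinearIsometryEquiv.apply_symm_apply]
    abel

end Cocycle

/-- The `p`-th moments of a cocycle along a symmetric random walk. -/
lemma exists_wordAvg_cocycle_le {G ι : Type} [Group G] [Fintype ι] [Nonempty ι] {p : ℝ}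
    (hp : 1 ≤ p) [Fact (1 ≤ ENNReal.ofReal p)] {Ω : Type} [MeasurableSpace Ω] {μ : Measure Ω}
    (σ : ι → G) (τ : ι ≃ ι) (hτ : ∀ i, σ (τ i) = (σ i)⁻¹)
    (π : G →* (Lp ℝ (ENNReal.ofReal p) μ ≃ₗᵢ[ℝ] Lp ℝ (ENNReal.ofReal p) μ))
    {b : G → Lp ℝ (ENNReal.ofReal p) μ} (hb : ∀ g h : G, b (g * h) = π g (b h) + b g) :
    ∃ C : ℝ, 0 < C ∧ ∀ n : ℕ, 0 < n →
      wordAvg n (fun l => ‖b (walk σ l)‖ ^ p) ≤ C * (n : ℝ) ^ (1 + max (p / 2 - 1) 0) := by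
  have hp0 : 0 < p := by linarith
  set v := (Fintype.card ι : ℝ)⁻¹ • ∑ i, b (σ i)
  have hv : ∑ i, (b (σ i) - v) = 0 := by
    rw [Finset.sum_sub_distrib, Finset.sum_const, Finset.card_univ, ← Nat.cast_smul_eq_nsmul ℝ,
      smul_inv_smul₀ (by positivity), sub_self]
  obtain ⟨C, hC, H⟩ := wordAvg_martingale_le hp (M := walkMartingale σ π b v)
    (L := ∑ i, ‖b (σ i) - v‖) rfl
    (fun l => by
      rw [Fintype.sum_prod_type]
      simp only [walkMartingale, add_sub_cancel_left, ← map_sum, hv, map_zero,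
        Finset.sum_const_zero])
    (fun l i => by
      simp only [walkMartingale, add_sub_cancel_left, LinearIsometryEquiv.norm_map]
      exact Finset.single_le_sum (f := fun i => ‖b (σ i) - v‖) (fun _ _ => norm_nonneg _)
        (Finset.mem_univ i.2))
  refine ⟨2 ^ p * (C + C), by positivity, fun n hn => ?_⟩
  let e : ι × ι ≃ ι × ι := (Equiv.prodComm ι ι).trans (τ.prodCongr τ)
  have h1 : wordAvg n (fun l => ‖walkMartingale σ π b v (l.map e).reverse‖ ^ p) =
      wordAvg n fun l => ‖walkMartingale σ π b v l‖ ^ p := by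
    rw [wordAvg_map e n fun l => ‖walkMartingale σ π b v l.reverse‖ ^ p,
      wordAvg_reverse n fun l => ‖walkMartingale σ π b v l‖ ^ p]
  calc wordAvg n (fun l => ‖b (walk σ l)‖ ^ p)
      ≤ wordAvg n (fun l => 2 ^ p * (‖walkMartingale σ π b v l‖ ^ p +
          ‖walkMartingale σ π b v (l.map e).reverse‖ ^ p)) := by
        refine wordAvg_mono n fun l => ?_
        refine le_trans ?_ (add_rpow_le_two_rpow_mul hp0.le (norm_nonneg _) (norm_nonneg _))
        refine Real.rpow_le_rpow (norm_nonneg _) ?_ hp0.le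
        rw [cocycle_walk σ π v hb τ hτ l]
        refine (norm_sub_le _ _).trans ?_
        rw [LinearIsometryEquiv.norm_map]
        rfl
    _ ≤ _ := by
      rw [wordAvg_const_mul, wordAvg_add, h1, mul_assoc, add_mul]
      gcongr <;> exact H n hn

section FreeGroup

open FreeGroup

lemma inv_letter {α : Type} (s : α × Bool) : (mk [s])⁻¹ = mk [(s.1, !s.2)] := by
  simp [inv_mk, invRev]

variable {α : Type} [DecidableEq α]

lemma toWord_letter_mul (s : α × Bool) (g : FreeGroup α) :
    (mk [s] * g).toWord =
      if g.toWord.head? = some (s.1, !s.2) then g.toWord.tail else s :: g.toWord := by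
  have h : mk [s] * g = mk (s :: g.toWord) := by
    conv_lhs => rw [← mk_toWord (x := g)]
    rfl
  rw [h, toWord_mk, reduce.cons, reduce_toWord]
  cases hw : g.toWord with
  | nil => simp
  | cons x l =>
    obtain ⟨a, c⟩ := s
    obtain ⟨a', c'⟩ := x
    by_cases ha : a = a' <;> cases c <;> cases c' <;> simp [ha, eq_comm]

lemma norm_letter_mul (s : α × Bool) (g : FreeGroup α) :
    (norm (mk [s] * g) : ℝ) =
      norm g + if g.toWord.head? = some (s.1, !s.2) then -1 else 1 := by
  rw [FreeGroup.norm, toWord_letter_mul, FreeGroup.norm]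
  cases hw : g.toWord with
  | nil => simp
  | cons x l =>
    by_cases h : x = (s.1, !s.2) <;> simp [h]

lemma norm_list_prod_le {w : List (FreeGroup α)}
    (hw : ∀ x ∈ w, x ∈ Set.range (of (α := α)) ∨ x⁻¹ ∈ Set.range (of (α := α))) :
    norm w.prod ≤ w.length := by
  induction w with
  | nil => simp
  | cons x w ih =>
    have h1 : norm x ≤ 1 := by
      rcases hw x (by simp) with ⟨a, ha⟩ | ⟨a, ha⟩
      · rw [← ha, norm_of]
      · rw [← norm_inv_eq, ← ha, norm_of]
    rw [List.prod_cons, List.length_cons]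
    have := ih fun y hy => hw y (by simp [hy])
    have := norm_mul_le x w.prod
    omega

lemma wordLength_range_of (g : FreeGroup α) : wordLength (Set.range (of (α := α))) g = norm g := by
  have hmem : norm g ∈ {n | ∃ w : List (FreeGroup α), w.length = n ∧
      (∀ x ∈ w, x ∈ Set.range (of (α := α)) ∨ x⁻¹ ∈ Set.range (of (α := α))) ∧ w.prod = g} := by
    refine ⟨g.toWord.map fun s => mk [s], by simp [FreeGroup.norm], ?_, ?_⟩
    · intro x hx
      obtain ⟨⟨a, c⟩, -, rfl⟩ := List.mem_map.1 hx
      cases c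
      · right
        exact ⟨a, by rw [inv_letter]; rfl⟩
      · left
        exact ⟨a, rfl⟩
    · conv_rhs => rw [← mk_toWord (x := g)]
      induction g.toWord with
      | nil => rfl
      | cons s l ih => rw [List.map_cons, List.prod_cons, ih]; rfl
  refine le_antisymm (Nat.sInf_le hmem) (le_csInf ⟨_, hmem⟩ ?_)
  rintro n ⟨w, rfl, hw, rfl⟩
  exact norm_list_prod_le hw

lemma wordDist_range_of (g h : FreeGroup α) :
    wordDist (Set.range (of (α := α))) g h = norm (g⁻¹ * h) := by
  rw [wordDist, wordLength_range_of]

lemma le_sum_norm_letter_mul (g : FreeGroup (Fin 2)) :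
    4 * (norm g : ℝ) + 2 ≤ ∑ s : Fin 2 × Bool, (norm (mk [s] * g) : ℝ) := by
  simp only [norm_letter_mul, Finset.sum_add_distrib, Finset.sum_const]
  have h : (2 : ℝ) ≤ ∑ s : Fin 2 × Bool,
      if g.toWord.head? = some (s.1, !s.2) then (-1 : ℝ) else 1 := by
    cases hw : g.toWord.head? with
    | none => simp; norm_num
    | some x =>
      obtain ⟨a, c⟩ := x
      fin_cases a <;> cases c <;> simp [Fintype.sum_prod_type] <;> norm_num
  simp
  linarith

/-- Inversion of letters. -/
def letterInv : Fin 2 × Bool ≃ Fin 2 × Bool := (Equiv.refl _).prodCongr Equiv.boolNot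

lemma mk_letterInv (s : Fin 2 × Bool) : mk [letterInv s] = (mk [s])⁻¹ := by
  rw [inv_letter]; rfl

lemma le_sum_norm_mul_letter (g : FreeGroup (Fin 2)) :
    4 * (norm g : ℝ) + 2 ≤ ∑ s : Fin 2 × Bool, (norm (g * mk [s]) : ℝ) := by
  rw [← letterInv.sum_comp]
  simp only [mk_letterInv]
  calc _ = 4 * (norm g⁻¹ : ℝ) + 2 := by rw [norm_inv_eq]
    _ ≤ _ := le_sum_norm_letter_mul g⁻¹
    _ = _ := by
      refine Finset.sum_congr rfl fun s _ => ?_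
      rw [← norm_inv_eq]
      simp

lemma le_wordAvg_norm_walk (n : ℕ) :
    n ≤ wordAvg n fun l => (norm (walk (fun s : Fin 2 × Bool => mk [s]) l) : ℝ) := by
  refine le_wordAvg_of_drift (by positivity) (fun l => ?_) n
  rw [Fintype.sum_prod_type]
  simp only [walk]
  set g := walk (fun s : Fin 2 × Bool => mk [s]) l
  have h1 : ∑ s : Fin 2 × Bool, (4 * (norm (g * mk [s]) : ℝ) + 2) ≤
      ∑ s : Fin 2 × Bool, ∑ t : Fin 2 × Bool, (norm (g * mk [s] * mk [t]) : ℝ) :=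
    Finset.sum_le_sum fun s _ => le_sum_norm_mul_letter _
  have h2 := le_sum_norm_mul_letter g
  rw [Finset.sum_add_distrib, ← Finset.mul_sum] at h1
  simp at h1 ⊢
  linarith

end FreeGroup

lemma one_add_max_eq {p : ℝ} (hp : 1 ≤ p) :
    1 + max (p / 2 - 1) 0 = max (1 / 2) (1 / p) * p := by
  have hp0 : 0 < p := by linarith
  rw [max_mul_of_nonneg _ _ hp0.le, ← max_add_add_left, one_div_mul_cancel hp0.ne']
  congr 1 <;> ring

lemma le_of_forall_rpow_le {a b C : ℝ} (h : ∀ n : ℕ, 0 < n → (n : ℝ) ^ a ≤ C * (n : ℝ) ^ b) :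
    a ≤ b := by
  by_contra! hab
  have h1 := (tendsto_rpow_atTop (sub_pos.2 hab)).comp tendsto_natCast_atTop_atTop
  obtain ⟨n, hn, hn0⟩ := ((h1.eventually_gt_atTop C).and (Filter.eventually_gt_atTop 0)).exists
  have hn' : (0 : ℝ) < n := by exact_mod_cast hn0
  have h2 := h n hn0
  rw [Function.comp, Real.rpow_sub hn', lt_div_iff₀ (by positivity)] at hn
  linarith

lemma le_of_mem_equivCompressionSet {p : ℝ} (hp : 1 ≤ p) [Fact (1 ≤ ENNReal.ofReal p)] {r : ℝ}
    (hr : r ∈ equivCompressionSet (FreeGroup (Fin 2))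
      (wordDist (Set.range (FreeGroup.of (α := Fin 2)))) p) : r ≤ max (1 / 2) (1 / p) := by
  obtain ⟨hr0, hr1, Ω, _, μ, π, b, hb, -, C, hC, D, hD, H⟩ := hr
  have hp0 : 0 < p := by linarith
  by_contra! hlt
  have hrp : 1 ≤ r * p := by
    have : 1 / p < r := (le_max_right _ _).trans_lt hlt
    rw [div_lt_iff₀ hp0] at this
    exact this.le
  have hnorm : ∀ g : FreeGroup (Fin 2),
      (g.norm : ℝ) ^ (r * p) ≤ C ^ p * 2 ^ p * D ^ p + C ^ p * 2 ^ p * ‖b g‖ ^ p := by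
    intro g
    have h1 := H 1 g
    rw [cocycle_one π hb, zero_sub, norm_neg, wordDist_range_of, inv_one, one_mul, sub_le_iff_le_add,
      one_div_mul_eq_div, div_le_iff₀' hC] at h1
    calc (g.norm : ℝ) ^ (r * p) = ((g.norm : ℝ) ^ r) ^ p := Real.rpow_mul (by positivity) _ _
      _ ≤ (C * (‖b g‖ + D)) ^ p := by gcongr
      _ = C ^ p * (‖b g‖ + D) ^ p := Real.mul_rpow hC.le (by positivity)
      _ ≤ C ^ p * (2 ^ p * (‖b g‖ ^ p + D ^ p)) := by
        gcongr
        exact add_rpow_le_two_rpow_mul hp0.le (norm_nonneg _) hD.le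
      _ = _ := by ring
  obtain ⟨K, hK, HK⟩ := exists_wordAvg_cocycle_le hp (fun s : Fin 2 × Bool => FreeGroup.mk [s])
    letterInv mk_letterInv π hb
  rw [one_add_max_eq hp] at HK
  refine hlt.not_ge (le_of_mul_le_mul_right (le_of_forall_rpow_le
    (C := C ^ p * 2 ^ p * D ^ p + C ^ p * 2 ^ p * K) fun n hn => ?_) hp0)
  have hn1 : (1 : ℝ) ≤ n := by exact_mod_cast hn
  have hα : 0 ≤ max (1 / 2) (1 / p) * p := by positivity
  calc (n : ℝ) ^ (r * p) ≤ _ := Real.rpow_le_rpow (by positivity) (le_wordAvg_norm_walk n)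
        (by linarith)
    _ ≤ _ := wordAvg_rpow_le hrp n fun l => by positivity
    _ ≤ _ := wordAvg_mono n fun l => hnorm _
    _ = C ^ p * 2 ^ p * D ^ p * 1 + C ^ p * 2 ^ p * _ := by
      rw [wordAvg_add, wordAvg_const, wordAvg_const_mul, mul_one]
    _ ≤ C ^ p * 2 ^ p * D ^ p * (n : ℝ) ^ (max (1 / 2) (1 / p) * p) +
        C ^ p * 2 ^ p * (K * (n : ℝ) ^ (max (1 / 2) (1 / p) * p)) := by
      gcongr
      · exact Real.one_le_rpow hn1 hα
      · exact HK n hn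
    _ = _ := by ring

section Tree

open FreeGroup

/-- The indicator function of the half-tree of words that start with the `i`-th generator. -/
noncomputable def halfTree (i : Fin 2) (g : FreeGroup (Fin 2)) : ℝ :=
  if g.toWord.head? = some (i, true) then 1 else 0

/-- The flow, through the edge `e` of the Cayley tree, of the geodesic from `1` to `g`. -/
noncomputable def treeFlow (g : FreeGroup (Fin 2)) (e : FreeGroup (Fin 2) × Fin 2) : ℝ :=
  halfTree e.2 (e.1⁻¹ * g) - halfTree e.2 e.1⁻¹

/-- The action of the free group on the oriented edges of its Cayley tree. -/
def edgeShift (g : FreeGroup (Fin 2)) :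
    FreeGroup (Fin 2) × Fin 2 ≃ FreeGroup (Fin 2) × Fin 2 :=
  (Equiv.mulLeft g).prodCongr (Equiv.refl _)

lemma edgeShift_mul_apply (g h : FreeGroup (Fin 2)) (e : FreeGroup (Fin 2) × Fin 2) :
    edgeShift (g * h) e = edgeShift g (edgeShift h e) := by
  obtain ⟨x, i⟩ := e
  simp [edgeShift, mul_assoc]

lemma edgeShift_symm (g : FreeGroup (Fin 2)) : (edgeShift g).symm = edgeShift g⁻¹ := by
  ext e <;> simp [edgeShift]

lemma treeFlow_mul (g h : FreeGroup (Fin 2)) (e : FreeGroup (Fin 2) × Fin 2) :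
    treeFlow (g * h) e = treeFlow h (edgeShift g⁻¹ e) + treeFlow g e := by
  simp [treeFlow, edgeShift, mul_assoc]

lemma treeFlow_one (e : FreeGroup (Fin 2) × Fin 2) : treeFlow 1 e = 0 := by simp [treeFlow]

lemma treeFlow_inv (g : FreeGroup (Fin 2)) (e : FreeGroup (Fin 2) × Fin 2) :
    treeFlow g⁻¹ e = -treeFlow g (edgeShift g e) := by
  have := treeFlow_mul g⁻¹ g e
  rw [inv_mul_cancel, treeFlow_one, inv_inv] at this
  linarith

lemma abs_treeFlow {g : FreeGroup (Fin 2)} {e : FreeGroup (Fin 2) × Fin 2}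
    (h : treeFlow g e ≠ 0) : |treeFlow g e| = 1 := by
  revert h
  unfold treeFlow halfTree
  split_ifs <;> simp

lemma halfTree_eq (i : Fin 2) (g : FreeGroup (Fin 2)) :
    halfTree i g = if g⁻¹.toWord.getLast? = some (i, false) then 1 else 0 := by
  rw [halfTree, toWord_inv, invRev, List.getLast?_reverse, List.head?_map]
  cases g.toWord.head? with
  | none => simp
  | some x =>
    obtain ⟨a, c⟩ := x
    simp

lemma halfTree_mul_of (i j : Fin 2) (g : FreeGroup (Fin 2)) :
    halfTree i (g * of j) - halfTree i g = if g = 1 ∧ i = j then 1 else 0 := by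
  have h1 : (g * of j)⁻¹ = mk [(j, false)] * g⁻¹ := by
    rw [mul_inv_rev]; rfl
  have h2 : g = 1 ↔ g⁻¹.toWord = [] := by rw [toWord_eq_nil_iff, inv_eq_one]
  simp only [halfTree_eq, h1, toWord_letter_mul, h2]
  rcases g⁻¹.toWord with - | ⟨x, - | ⟨y, l⟩⟩
  · simp [eq_comm]
  · by_cases hx : x = (j, true) <;> simp [hx]
  · by_cases hx : x = (j, true) <;> simp [hx]

lemma treeFlow_of (j : Fin 2) (e : FreeGroup (Fin 2) × Fin 2) :
    treeFlow (of j) e = if e = (1, j) then 1 else 0 := by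
  rw [treeFlow, halfTree_mul_of]
  simp [Prod.ext_iff]

lemma finite_support_treeFlow (g : FreeGroup (Fin 2)) : (treeFlow g).support.Finite := by
  have hmul : ∀ g h, (treeFlow g).support.Finite → (treeFlow h).support.Finite →
      (treeFlow (g * h)).support.Finite := by
    intro g h hg hh
    refine ((hh.preimage (edgeShift g⁻¹).injective.injOn).union hg).subset fun e he => ?_
    rw [Function.mem_support, treeFlow_mul] at he
    by_contra hne
    simp only [Set.mem_union, Set.mem_preimage, Function.mem_support, not_or, not_not] at hne
    exact he (by rw [hne.1, hne.2, add_zero])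
  have hof : ∀ i, (treeFlow (of i)).support.Finite := fun i =>
    (Set.finite_singleton (1, i)).subset fun e he => by
      by_contra hne
      rw [Function.mem_support, treeFlow_of, if_neg (by simpa using hne)] at he
      exact he rfl
  induction g using FreeGroup.induction_on with
  | C1 => simp [Function.support, treeFlow_one]
  | of i => exact hof i
  | inv_of i _ =>
    refine ((hof i).preimage (edgeShift (of i)).injective.injOn).subset fun e he => ?_
    rw [Function.mem_support, treeFlow_inv, neg_ne_zero] at he
    exact he
  | mul g h hg hh => exact hmul g h hg hh

/-- `treeFlow` as a finitely supported function. -/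
noncomputable def treeCocycle (g : FreeGroup (Fin 2)) : FreeGroup (Fin 2) × Fin 2 →₀ ℝ :=
  Finsupp.ofSupportFinite (treeFlow g) (finite_support_treeFlow g)

lemma treeCocycle_apply (g : FreeGroup (Fin 2)) (e : FreeGroup (Fin 2) × Fin 2) :
    treeCocycle g e = treeFlow g e := rfl

lemma treeCocycle_mul (g h : FreeGroup (Fin 2)) :
    treeCocycle (g * h) = (treeCocycle h).equivMapDomain (edgeShift g) + treeCocycle g := by
  ext e
  simp [treeCocycle_apply, treeFlow_mul, Finsupp.equivMapDomain_apply, edgeShift_symm]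

/-- A reduced leading letter contributes an edge not used by the remaining letters. -/
lemma exists_treeFlow_letter (s : Fin 2 × Bool) {g : FreeGroup (Fin 2)}
    (h : g.toWord.head? ≠ some (s.1, !s.2)) :
    ∃ e, (∀ e', treeFlow (mk [s]) e' ≠ 0 ↔ e' = e) ∧ treeFlow g (edgeShift (mk [s])⁻¹ e) = 0 := by
  obtain ⟨i, c⟩ := s
  cases c
  · have h1 : (mk [(i, false)] : FreeGroup (Fin 2)) = (of i)⁻¹ := rfl
    refine ⟨edgeShift (of i)⁻¹ (1, i), fun e' => ?_, ?_⟩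
    · rw [h1, treeFlow_inv, treeFlow_of, ← edgeShift_symm, Equiv.eq_symm_apply]
      simp
    · rw [h1, inv_inv, ← edgeShift_mul_apply]
      simpa [edgeShift, treeFlow, halfTree] using h
  · have h1 : (of i : FreeGroup (Fin 2)) = mk [(i, true)] := rfl
    refine ⟨(1, i), fun e' => ?_, ?_⟩
    · rw [← h1, treeFlow_of]
      simp
    · have h2 : halfTree i (mk [(i, true)] * g) = 1 := by
        rw [halfTree, toWord_letter_mul, if_neg h]
        simp
      have h3 : halfTree i (mk [(i, true)]) = 1 := by simp [halfTree, reduce]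
      simp [edgeShift, treeFlow, h2, h3]

lemma length_le_card_support_treeCocycle {l : List (Fin 2 × Bool)} (hl : IsReduced l) :
    l.length ≤ (treeCocycle (mk l)).support.card := by
  induction l with
  | nil => simp
  | cons s l ih =>
    have hl' : IsReduced l := List.IsChain.tail hl
    have hh : (mk l).toWord.head? ≠ some (s.1, !s.2) := by
      rw [toWord_mk, hl'.reduce_eq]
      cases l with
      | nil => simp
      | cons x l =>
        intro hx
        simp only [List.head?_cons, Option.some.injEq] at hx
        simpa [hx] using (isReduced_cons_cons.1 hl).1
    obtain ⟨e, he, he0⟩ := exists_treeFlow_letter s hh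
    have hs : treeCocycle (mk (s :: l)) =
        (treeCocycle (mk l)).equivMapDomain (edgeShift (mk [s])) + treeCocycle (mk [s]) :=
      treeCocycle_mul (mk [s]) (mk l)
    have hmem : e ∉ (treeCocycle (mk l)).support.map (edgeShift (mk [s])).toEmbedding := by
      rw [Finset.mem_map_equiv, edgeShift_symm, Finsupp.mem_support_iff, not_not]
      exact he0
    calc (s :: l).length ≤ (treeCocycle (mk l)).support.card + 1 := by
          simpa using ih hl'
      _ = (insert e ((treeCocycle (mk l)).support.map (edgeShift (mk [s])).toEmbedding)).card := by
          rw [Finset.card_insert_of_notMem hmem, Finset.card_map]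
      _ ≤ _ := by
          refine Finset.card_le_card fun e' he' => ?_
          rw [hs, Finsupp.mem_support_iff, Finsupp.add_apply, Finsupp.equivMapDomain_apply,
            edgeShift_symm, treeCocycle_apply, treeCocycle_apply]
          rcases Finset.mem_insert.1 he' with rfl | hm
          · rw [he0, zero_add]
            exact (he _).2 rfl
          · have hne : e' ≠ e := by
              rintro rfl
              exact hmem hm
            rw [not_not.1 (mt (he e').1 hne), add_zero]
            rwa [Finset.mem_map_equiv, edgeShift_symm, Finsupp.mem_support_iff] at hm

lemma norm_le_card_support_treeCocycle (g : FreeGroup (Fin 2)) :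
    g.norm ≤ (treeCocycle g).support.card := by
  have := length_le_card_support_treeCocycle (isReduced_toWord (x := g))
  rwa [mk_toWord] at this

end Tree

/-- The isometric representation on `L^p` given by a measure preserving right action. -/
noncomputable def koopman {G Ω : Type} [Group G] [MeasurableSpace Ω] {μ : Measure Ω}
    (q : ENNReal) [Fact (1 ≤ q)] (T : G → Ω → Ω) (hT : ∀ g, MeasurePreserving (T g) μ μ)
    (h1 : T 1 = id) (hmul : ∀ g h, T (g * h) = T h ∘ T g) : G →* (Lp ℝ q μ ≃ₗᵢ[ℝ] Lp ℝ q μ) :=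
  have hcomp : ∀ g h f, Lp.compMeasurePreserving (T g) (hT g)
      (Lp.compMeasurePreserving (T h) (hT h) f) =
        (Lp.compMeasurePreserving (T (g * h)) (hT (g * h)) f : Lp ℝ q μ) := by
    intro g h f
    rw [← Lp.compMeasurePreserving_comp_apply]
    congr 2
    exact (hmul g h).symm
  have hone : ∀ f, Lp.compMeasurePreserving (T 1) (hT 1) f = (f : Lp ℝ q μ) := by
    intro f
    conv_rhs => rw [← Lp.compMeasurePreserving_id_apply f]
    congr 2
  { toFun := fun g =>
      { toLinearEquiv := LinearEquiv.ofLinearMap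
          (Lp.compMeasurePreservingₗ ℝ (T g) (hT g)) (Lp.compMeasurePreservingₗ ℝ (T g⁻¹) (hT g⁻¹))
          (LinearMap.ext fun f => by
            refine (hcomp g g⁻¹ f).trans ?_
            simp only [mul_inv_cancel]
            exact hone f)
          (LinearMap.ext fun f => by
            refine (hcomp g⁻¹ g f).trans ?_
            simp only [inv_mul_cancel]
            exact hone f)
        norm_map' := fun f => Lp.norm_compMeasurePreserving f (hT g) }
    map_one' := LinearIsometryEquiv.ext hone
    map_mul' := fun g h => LinearIsometryEquiv.ext fun f => (hcomp g h f).symm }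

lemma koopman_toLp {G Ω : Type} [Group G] [MeasurableSpace Ω] {μ : Measure Ω}
    (q : ENNReal) [Fact (1 ≤ q)] (T : G → Ω → Ω) (hT : ∀ g, MeasurePreserving (T g) μ μ)
    (h1 : T 1 = id) (hmul : ∀ g h, T (g * h) = T h ∘ T g) (g : G) {f : Ω → ℝ} (hf : MemLp f q μ) :
    koopman q T hT h1 hmul g (hf.toLp f) = (hf.comp_measurePreserving (hT g)).toLp _ := rfl

lemma norm_cocycle_sub {G V : Type*} [Group G] [NormedAddCommGroup V] [NormedSpace ℝ V]
    (π : G →* (V ≃ₗᵢ[ℝ] V)) {b : G → V} (hb : ∀ g h : G, b (g * h) = π g (b h) + b g) (g h : G) :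
    ‖b g - b h‖ = ‖b (g⁻¹ * h)‖ := by
  have h1 := hb g (g⁻¹ * h)
  rw [mul_inv_cancel_left] at h1
  rw [h1, norm_sub_rev, add_sub_cancel_right, LinearIsometryEquiv.norm_map]

lemma norm_cocycle_le {V : Type*} [NormedAddCommGroup V] [NormedSpace ℝ V]
    (π : FreeGroup (Fin 2) →* (V ≃ₗᵢ[ℝ] V)) {b : FreeGroup (Fin 2) → V}
    (hb : ∀ g h, b (g * h) = π g (b h) + b g) (g : FreeGroup (Fin 2)) :
    ‖b g‖ ≤ (∑ s : Fin 2 × Bool, ‖b (FreeGroup.mk [s])‖) * g.norm := by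
  have key : ∀ l : List (Fin 2 × Bool), ‖b (FreeGroup.mk l)‖ ≤
      (∑ s : Fin 2 × Bool, ‖b (FreeGroup.mk [s])‖) * l.length := by
    intro l
    induction l with
    | nil =>
      have h1 : b (FreeGroup.mk []) = 0 := cocycle_one π hb
      simp [h1]
    | cons s l ih =>
      have h1 : b (FreeGroup.mk (s :: l)) = _ := hb (FreeGroup.mk [s]) (FreeGroup.mk l)
      have h2 := Finset.single_le_sum (f := fun s => ‖b (FreeGroup.mk [s])‖)
        (fun _ _ => norm_nonneg _) (Finset.mem_univ s)
      rw [h1, List.length_cons, Nat.cast_add_one, mul_add_one]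
      refine (norm_add_le _ _).trans ?_
      rw [LinearIsometryEquiv.norm_map]
      exact add_le_add ih h2
  simpa [FreeGroup.mk_toWord, FreeGroup.norm] using key g.toWord

lemma mem_equivCompressionSet_of_edges {p : ℝ} [Fact (1 ≤ ENNReal.ofReal p)] {r : ℝ}
    (hr0 : 0 ≤ r) (hr1 : r ≤ 1) {Ω : Type} [MeasurableSpace Ω] {μ : Measure Ω}
    (T : FreeGroup (Fin 2) → Ω → Ω) (hT : ∀ g, MeasurePreserving (T g) μ μ)
    (h1 : T 1 = id) (hmul : ∀ g h, T (g * h) = T h ∘ T g)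
    (U : FreeGroup (Fin 2) × Fin 2 → Ω → ℝ) (hU : ∀ e, MemLp (U e) (ENNReal.ofReal p) μ)
    (hUT : ∀ g e, U (edgeShift g e) = U e ∘ T g)
    (hlow : ∀ c : FreeGroup (Fin 2) × Fin 2 →₀ ℝ, (∀ e ∈ c.support, |c e| = 1) →
      (c.support.card : ℝ) ^ r ≤
        (eLpNorm (fun x => ∑ e ∈ c.support, c e * U e x) (ENNReal.ofReal p) μ).toReal) :
    r ∈ equivCompressionSet (FreeGroup (Fin 2))
      (wordDist (Set.range (FreeGroup.of (α := Fin 2)))) p := by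
  set π := koopman (ENNReal.ofReal p) T hT h1 hmul with hπ
  let u : FreeGroup (Fin 2) × Fin 2 → Lp ℝ (ENNReal.ofReal p) μ := fun e => (hU e).toLp
  have hu : ∀ g e, π g (u e) = u (edgeShift g e) := by
    intro g e
    rw [hπ, koopman_toLp]
    simp only [u, hUT]
  let b : FreeGroup (Fin 2) → Lp ℝ (ENNReal.ofReal p) μ := fun g =>
    Finsupp.linearCombination ℝ u (treeCocycle g)
  have hb : ∀ g h, b (g * h) = π g (b h) + b g := by
    intro g h
    simp only [b, treeCocycle_mul, map_add, Finsupp.linearCombination_equivMapDomain]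
    congr 1
    simp only [Finsupp.linearCombination_apply, Finsupp.sum, map_sum, map_smul, hu,
      Function.comp_apply]
  have hnorm : ∀ g, ‖b g‖ = (eLpNorm (fun x => ∑ e ∈ (treeCocycle g).support,
      treeCocycle g e * U e x) (ENNReal.ofReal p) μ).toReal := by
    intro g
    rw [Lp.norm_def]
    congr 1
    refine eLpNorm_congr_ae ?_
    have h2 : ∀ᵐ x ∂μ, ∀ e ∈ (treeCocycle g).support,
        (treeCocycle g e • u e : Lp ℝ (ENNReal.ofReal p) μ) x = treeCocycle g e * U e x := by
      refine (Finset.eventually_all _).2 fun e _ => ?_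
      filter_upwards [Lp.coeFn_smul (treeCocycle g e) (u e), (hU e).coeFn_toLp] with x h3 h4
      rw [h3, Pi.smul_apply, h4, smul_eq_mul]
    have h5 := Lp.coeFn_finsetSum (treeCocycle g).support fun e => treeCocycle g e • u e
    filter_upwards [h2, h5] with x h2 h5
    simp only [b, Finsupp.linearCombination_apply, Finsupp.sum]
    rw [h5, Finset.sum_apply]
    exact Finset.sum_congr rfl h2
  refine ⟨hr0, hr1, Ω, _, μ, π, b, hb, ⟨(∑ s : Fin 2 × Bool, ‖b (FreeGroup.mk [s])‖) + 1,
    by positivity, fun g h => ?_⟩, 1, one_pos, 1, one_pos, fun g h => ?_⟩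
  · rw [norm_cocycle_sub π hb, wordDist_range_of]
    refine (norm_cocycle_le π hb _).trans ?_
    gcongr
    linarith
  · rw [norm_cocycle_sub π hb, wordDist_range_of, hnorm]
    have h2 := hlow (treeCocycle (g⁻¹ * h)) fun e he =>
      abs_treeFlow (Finsupp.mem_support_iff.1 he)
    have h3 : ((g⁻¹ * h).norm : ℝ) ^ r ≤ ((treeCocycle (g⁻¹ * h)).support.card : ℝ) ^ r := by
      gcongr
      exact norm_le_card_support_treeCocycle _
    linarith

lemma measurePreserving_count_equiv {α : Type*} [MeasurableSpace α] [DiscreteMeasurableSpace α]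
    (f : α ≃ α) : MeasurePreserving f Measure.count Measure.count := by
  refine ⟨.of_discrete, Measure.ext fun s hs => ?_⟩
  rw [Measure.map_apply .of_discrete hs, Measure.count_apply (.of_discrete), Measure.count_apply hs,
    Set.encard_preimage_of_bijective f.bijective]

lemma eLpNorm_count_sum_indicator {α : Type*} [MeasurableSpace α] [DiscreteMeasurableSpace α]
    {p : ℝ} (hp : 0 < p) {c : α →₀ ℝ} (hc : ∀ a ∈ c.support, |c a| = 1) :
    eLpNorm (fun x => ∑ a ∈ c.support, c a * ({a} : Set α).indicator 1 x) (ENNReal.ofReal p)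
      Measure.count = (c.support.card : ENNReal) ^ (1 / p) := by
  classical
  have hsum : (fun x => ∑ a ∈ c.support, c a * ({a} : Set α).indicator 1 x) = c := by
    ext x
    simp [Set.indicator_apply, eq_comm]
  rw [hsum, eLpNorm_eq_lintegral_rpow_enorm_toReal (by simpa using hp) ENNReal.ofReal_ne_top,
    ENNReal.toReal_ofReal hp.le, lintegral_count, tsum_eq_sum (s := c.support) fun a ha => by
      rw [Finsupp.notMem_support_iff.1 ha, enorm_zero, ENNReal.zero_rpow_of_pos hp]]
  congr 1
  rw [Finset.sum_congr rfl fun a ha => (by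
    rw [Real.enorm_eq_ofReal_abs, hc a ha, ENNReal.ofReal_one, ENNReal.one_rpow] :
      ‖c a‖ₑ ^ p = 1)]
  simp

/-- The permutation action on edges realises the exponent `1 / p`. -/
lemma one_div_mem_equivCompressionSet (p : ℝ) (hp : 1 ≤ p) [Fact (1 ≤ ENNReal.ofReal p)] :
    1 / p ∈ equivCompressionSet (FreeGroup (Fin 2))
      (wordDist (Set.range (FreeGroup.of (α := Fin 2)))) p := by
  let : MeasurableSpace (FreeGroup (Fin 2) × Fin 2) := ⊤
  have hp0 : 0 < p := by linarith
  refine mem_equivCompressionSet_of_edges (by positivity) ((div_le_one hp0).2 hp)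
    (μ := Measure.count) (fun g => edgeShift g⁻¹) (fun g => measurePreserving_count_equiv _)
    ?_ ?_ (fun e => ({e} : Set _).indicator 1) (fun e => ?_) ?_ fun c hc => ?_
  · ext1 e
    simp [edgeShift]
  · intro g h
    ext1 e
    rw [mul_inv_rev, edgeShift_mul_apply]
    rfl
  · exact memLp_indicator_const _ .of_discrete 1 (.inr (by simp))
  · intro g e
    ext x
    simp [Set.indicator_apply, -Set.indicator_singleton, ← edgeShift_symm, Equiv.symm_apply_eq]
  · rw [eLpNorm_count_sum_indicator hp0 hc, ← ENNReal.toReal_rpow, ENNReal.toReal_natCast]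

section Gaussian

open ProbabilityTheory

/-- The law of a family of independent standard Gaussian variables. -/
noncomputable abbrev gaussianFamily (ι : Type*) : Measure (ι → ℝ) :=
  Measure.infinitePi fun _ => gaussianReal 0 1

lemma memLp_eval_gaussianFamily {ι : Type*} (i : ι) {q : ENNReal} (hq : q ≠ ⊤) :
    MemLp (fun ω : ι → ℝ => ω i) q (gaussianFamily ι) :=
  (memLp_id_gaussianReal' q hq).comp_measurePreserving
    (measurePreserving_eval_infinitePi (fun _ => gaussianReal 0 1) i)

lemma measurePreserving_gaussianFamily {ι : Type*} (f : ι ≃ ι) :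
    MeasurePreserving (fun ω : ι → ℝ => ω ∘ f) (gaussianFamily ι) (gaussianFamily ι) :=
  ⟨by fun_prop, Measure.map_infinitePi_infinitePi_of_inj f.injective⟩

lemma variance_sum_gaussianFamily {ι : Type*} {c : ι →₀ ℝ} (hc : ∀ i ∈ c.support, |c i| = 1) :
    Var[fun ω => ∑ i ∈ c.support, c i * ω i; gaussianFamily ι] = c.support.card := by
  have hind : iIndepFun (fun i (ω : ι → ℝ) => c i * ω i) (gaussianFamily ι) :=
    iIndepFun_infinitePi (X := fun i x => c i * x) fun i => by fun_prop
  have h := IndepFun.variance_sum (s := c.support)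
    (fun i _ => (memLp_eval_gaussianFamily i ENNReal.ofNat_ne_top).const_mul (c i))
    fun i _ j _ hij => hind.indepFun hij
  rw [show (fun ω : ι → ℝ => ∑ i ∈ c.support, c i * ω i) =
    ∑ i ∈ c.support, fun ω : ι → ℝ => c i * ω i by ext; simp, h,
    Finset.sum_congr rfl fun i hi => (?_ : _ = (1 : ℝ))]
  · simp
  · rw [variance_const_mul, ← sq_abs, hc i hi, one_pow, one_mul,
      (measurePreserving_eval_infinitePi (fun _ : ι => gaussianReal 0 1) i).variance_fun_comp
        (f := fun x => x) (by fun_prop), variance_fun_id_gaussianReal, NNReal.coe_one]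

/-- The Gaussian action associated with the permutation action on edges realises the exponent
`1 / 2`. -/
lemma half_mem_equivCompressionSet (p : ℝ) (hp : 2 ≤ p) [Fact (1 ≤ ENNReal.ofReal p)] :
    1 / 2 ∈ equivCompressionSet (FreeGroup (Fin 2))
      (wordDist (Set.range (FreeGroup.of (α := Fin 2)))) p := by
  refine mem_equivCompressionSet_of_edges (by norm_num) (by norm_num)
    (μ := gaussianFamily (FreeGroup (Fin 2) × Fin 2)) (fun g ω => ω ∘ edgeShift g)
    (fun g => measurePreserving_gaussianFamily _) ?_ ?_ (fun e ω => ω e)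
    (fun e => memLp_eval_gaussianFamily e ENNReal.ofReal_ne_top) (fun g e => rfl) fun c hc => ?_
  · ext ω e
    simp [edgeShift]
  · intro g h
    ext ω e
    simp [edgeShift_mul_apply]
  · have hq : ENNReal.ofReal p ≠ ⊤ := ENNReal.ofReal_ne_top
    set X : (FreeGroup (Fin 2) × Fin 2 → ℝ) → ℝ := fun ω => ∑ e ∈ c.support, c e * ω e
    have hmem : ∀ {q : ENNReal}, q ≠ ⊤ → MemLp X q (gaussianFamily _) := fun hq =>
      memLp_finsetSum _ fun e _ => (memLp_eval_gaussianFamily e hq).const_mul (c e)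
    have h2 : (2 : ENNReal) ≤ ENNReal.ofReal p := by
      rw [← ENNReal.ofReal_ofNat]
      exact ENNReal.ofReal_le_ofReal hp
    have h3 := eLpNorm_le_eLpNorm_of_exponent_le h2 (hmem hq).1
    refine le_trans ?_ (ENNReal.toReal_mono (hmem hq).2.ne h3)
    have hM := hmem (q := 2) ENNReal.ofNat_ne_top
    rw [hM.eLpNorm_eq_integral_rpow_norm two_ne_zero ENNReal.ofNat_ne_top,
      ENNReal.toReal_ofReal (by positivity), ENNReal.toReal_ofNat, one_div]
    gcongr
    rw [← variance_sum_gaussianFamily hc]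
    refine (variance_le_expectation_sq hM.1).trans_eq ?_
    simp

end Gaussian

/-- The equivariant `L^p`-compression of the free group on two
generators equals `max (1/2) (1/p)`. -/
theorem equivCompression_freeGroup (p : ℝ) (hp : 1 ≤ p)
    [Fact (1 ≤ ENNReal.ofReal p)] :
    equivCompression (FreeGroup (Fin 2))
      (wordDist (Set.range (FreeGroup.of (α := Fin 2)))) p = max (1 / 2) (1 / p) := by
  refine IsGreatest.csSup_eq ⟨?_, fun r hr => le_of_mem_equivCompressionSet hp hr⟩
  rcases le_total p 2 with h | h
  · rw [max_eq_right (by gcongr)]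
    exact one_div_mem_equivCompressionSet p hp
  · rw [max_eq_left (by gcongr)]
    exact half_mem_equivCompressionSet p h
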